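/- Let m ≥ 3 be an integer, let Ω ⊆ ℝ^m ∖ {0} be open, and let F : Ω → ℝ be twice continuously differentiable. Define Ω* = {x ∈ ℝ^m ∖ {0} : x/|x|² ∈ Ω} and f : Ω* → ℝ by f(x) = |x|^{2−m} · F(x/|x|²). Then for every x ∈ Ω*: Σ_{i=1}^{m} (∂²f/∂x_i²)(x) = |x|^{−m−2} · Σ_{i=1}^{m} (∂²F/∂y_i²)(x/|x|²). Equivalently, writing y ∈ Ω, s = |y| and x = y/s², one has Σ_{i=1}^m (∂²f/∂x_i²)(y/s²) = s^{m+2} · Σ_{i=1}^m (∂²F/∂y_i²)(y); in particular f is harmonic on Ω* if and only if F is harmonic on Ω ∩ {y : y/|y|² ∈ Ω*}. -/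

import Mathlib

section KelvinAux
variable {E : Type*} [NormedAddCommGroup E] [InnerProductSpace ℝ E]

lemma kelvin_line (x v : E) : HasDerivAt (fun t : ℝ => x + t • v) v 0 := by
  simpa using ((hasDerivAt_id (0:ℝ)).smul_const v).const_add x

lemma kelvin_N (x v : E) :
    HasDerivAt (fun t : ℝ => ‖x + t • v‖ ^ 2) (2 * inner ℝ x v) 0 := by
  simpa using (kelvin_line x v).norm_sq

lemma kelvin_ip (x v : E) :
    HasDerivAt (fun t : ℝ => inner ℝ (x + t • v) v) (inner ℝ v v) 0 := by
  simpa using (kelvin_line x v).inner ℝ (hasDerivAt_const (0:ℝ) v)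

lemma kelvin_pow (x v : E) (hx : x ≠ 0) (a : ℝ) :
    HasDerivAt (fun t : ℝ => (‖x + t • v‖ ^ 2) ^ a)
      (2 * a * (‖x‖ ^ 2) ^ (a - 1) * inner ℝ x v) 0 := by
  have h := (kelvin_N x v).rpow_const (p := a) (Or.inl (by simpa using hx))
  convert h using 1
  simp
  ring

lemma kelvin_inv (x v : E) (hx : x ≠ 0) :
    HasDerivAt (fun t : ℝ => (‖x + t • v‖ ^ 2)⁻¹)
      (-2 * ((‖x‖ ^ 2)⁻¹) ^ 2 * inner ℝ x v) 0 := by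
  have h := (kelvin_N x v).inv (by simpa using hx)
  refine h.congr_deriv ?_
  simp only [zero_smul, add_zero]
  field_simp

/-- first derivative of the inversion -/
noncomputable def kelvinD (x v : E) : E :=
  (-2 * ((‖x‖ ^ 2)⁻¹) ^ 2 * inner ℝ x v) • x + (‖x‖ ^ 2)⁻¹ • v

lemma kelvin_inversion (x v : E) (hx : x ≠ 0) :
    HasDerivAt (fun t : ℝ => (‖x + t • v‖ ^ 2)⁻¹ • (x + t • v)) (kelvinD x v) 0 := by
  have h := (kelvin_inv x v hx).smul (kelvin_line x v)
  refine h.congr_deriv ?_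
  simp only [kelvinD, zero_smul, add_zero]
  abel

lemma kelvin_inversion2 (x v : E) (hx : x ≠ 0) :
    HasDerivAt (fun t : ℝ => kelvinD (x + t • v) v)
      ((8 * ((‖x‖ ^ 2)⁻¹) ^ 3 * (inner ℝ x v) ^ 2
          - 2 * ((‖x‖ ^ 2)⁻¹) ^ 2 * inner ℝ v v) • x
        + (-4 * ((‖x‖ ^ 2)⁻¹) ^ 2 * inner ℝ x v) • v) 0 := by
  have h1 := ((((kelvin_inv x v hx).pow 2).const_mul (-2)).mul (kelvin_ip x v)).smul
    (kelvin_line x v)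
  have h := h1.add ((kelvin_inv x v hx).smul_const v)
  refine h.congr_deriv ?_
  simp only [zero_smul, add_zero, Pi.mul_apply, Pi.pow_apply]
  norm_num
  module

/-- first derivative of the Kelvin transform -/
noncomputable def kelvinG (a : ℝ) (F : E → ℝ) (x v : E) : ℝ :=
  2 * a * (‖x‖ ^ 2) ^ (a - 1) * inner ℝ x v * F ((‖x‖ ^ 2)⁻¹ • x)
    + (‖x‖ ^ 2) ^ a * fderiv ℝ F ((‖x‖ ^ 2)⁻¹ • x) (kelvinD x v)

lemma kelvin_F (F : E → ℝ) (x v : E) (hx : x ≠ 0)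
    (hF : DifferentiableAt ℝ F ((‖x‖ ^ 2)⁻¹ • x)) :
    HasDerivAt (fun t : ℝ => F ((‖x + t • v‖ ^ 2)⁻¹ • (x + t • v)))
      (fderiv ℝ F ((‖x‖ ^ 2)⁻¹ • x) (kelvinD x v)) 0 := by
  have h : HasFDerivAt F (fderiv ℝ F ((‖x‖ ^ 2)⁻¹ • x))
      ((fun t : ℝ => (‖x + t • v‖ ^ 2)⁻¹ • (x + t • v)) 0) := by
    simpa using hF.hasFDerivAt
  exact h.comp_hasDerivAt 0 (kelvin_inversion x v hx)

lemma kelvin_first (a : ℝ) (F : E → ℝ) (x v : E) (hx : x ≠ 0)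
    (hF : DifferentiableAt ℝ F ((‖x‖ ^ 2)⁻¹ • x)) :
    HasDerivAt (fun t : ℝ => (‖x + t • v‖ ^ 2) ^ a * F ((‖x + t • v‖ ^ 2)⁻¹ • (x + t • v)))
      (kelvinG a F x v) 0 := by
  have h := (kelvin_pow x v hx a).mul (kelvin_F F x v hx hF)
  refine h.congr_deriv ?_
  simp only [kelvinG, zero_smul, add_zero]

lemma kelvin_second (a : ℝ) (F : E → ℝ) (x v : E) (hx : x ≠ 0)
    (hF : DifferentiableAt ℝ F ((‖x‖ ^ 2)⁻¹ • x))
    (hF2 : DifferentiableAt ℝ (fderiv ℝ F) ((‖x‖ ^ 2)⁻¹ • x)) :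
    HasDerivAt (fun t : ℝ => kelvinG a F (x + t • v) v)
      ((4 * a * (a - 1) * (‖x‖ ^ 2) ^ (a - 2) * (inner ℝ x v) ^ 2
          + 2 * a * (‖x‖ ^ 2) ^ (a - 1) * inner ℝ v v) * F ((‖x‖ ^ 2)⁻¹ • x)
        + 4 * a * (‖x‖ ^ 2) ^ (a - 1) * inner ℝ x v
          * fderiv ℝ F ((‖x‖ ^ 2)⁻¹ • x) (kelvinD x v)
        + (‖x‖ ^ 2) ^ a *
          (fderiv ℝ (fderiv ℝ F) ((‖x‖ ^ 2)⁻¹ • x) (kelvinD x v) (kelvinD x v)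
          + fderiv ℝ F ((‖x‖ ^ 2)⁻¹ • x)
            ((8 * ((‖x‖ ^ 2)⁻¹) ^ 3 * (inner ℝ x v) ^ 2
              - 2 * ((‖x‖ ^ 2)⁻¹) ^ 2 * inner ℝ v v) • x
              + (-4 * ((‖x‖ ^ 2)⁻¹) ^ 2 * inner ℝ x v) • v))) 0 := by
  have h0 : HasFDerivAt (fderiv ℝ F) (fderiv ℝ (fderiv ℝ F) ((‖x‖ ^ 2)⁻¹ • x))
      ((fun t : ℝ => (‖x + t • v‖ ^ 2)⁻¹ • (x + t • v)) 0) := by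
    simpa using hF2.hasFDerivAt
  have h00 : HasDerivAt (fun t : ℝ => fderiv ℝ F ((‖x + t • v‖ ^ 2)⁻¹ • (x + t • v)))
      (fderiv ℝ (fderiv ℝ F) ((‖x‖ ^ 2)⁻¹ • x) (kelvinD x v)) 0 :=
    h0.comp_hasDerivAt (0:ℝ) (kelvin_inversion x v hx)
  have h1 := h00.clm_apply (kelvin_inversion2 x v hx)
  have h2 := (kelvin_pow x v hx a).mul h1
  have h3 := ((((kelvin_pow x v hx (a - 1)).const_mul (2 * a)).mul (kelvin_ip x v)).mul
    (kelvin_F F x v hx hF)).add h2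
  refine h3.congr_deriv ?_
  simp only [Function.comp, zero_smul, add_zero, Pi.mul_apply]
  rw [show a - 1 - 1 = a - 2 by ring]
  ring

lemma kelvin_hess (f : E → ℝ) (G : E → ℝ) (x v : E) (c : ℝ)
    (hf : DifferentiableAt ℝ (fderiv ℝ f) x)
    (hG : ∀ᶠ z in nhds x, fderiv ℝ f z v = G z)
    (h : HasDerivAt (fun t : ℝ => G (x + t • v)) c 0) :
    fderiv ℝ (fderiv ℝ f) x v v = c := by
  have h0 : HasFDerivAt (fderiv ℝ f) (fderiv ℝ (fderiv ℝ f) x)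
      ((fun t : ℝ => x + t • v) 0) := by
    simpa using hf.hasFDerivAt
  have h00 : HasDerivAt (fun t : ℝ => fderiv ℝ f (x + t • v))
      (fderiv ℝ (fderiv ℝ f) x v) 0 :=
    h0.comp_hasDerivAt (0:ℝ) (kelvin_line x v)
  have h1 : HasDerivAt (fun t : ℝ => fderiv ℝ f (x + t • v) v)
      (fderiv ℝ (fderiv ℝ f) x v v) 0 := by
    have := h00.clm_apply (hasDerivAt_const (0:ℝ) v)
    simpa only [map_zero, add_zero] using this
  have ht : Filter.Tendsto (fun t : ℝ => x + t • v) (nhds 0) (nhds x) := by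
    simpa using (kelvin_line x v).continuousAt.tendsto
  have h2 : HasDerivAt (fun t : ℝ => fderiv ℝ f (x + t • v) v) c 0 :=
    h.congr_of_eventuallyEq (ht.eventually hG)
  exact h1.unique h2

lemma kelvin_grad (f : E → ℝ) (g : E → ℝ) (x v : E) (c : ℝ)
    (hf : DifferentiableAt ℝ f x)
    (hG : ∀ᶠ z in nhds x, f z = g z)
    (h : HasDerivAt (fun t : ℝ => g (x + t • v)) c 0) :
    fderiv ℝ f x v = c := by
  have h0 : HasFDerivAt f (fderiv ℝ f x) ((fun t : ℝ => x + t • v) 0) := by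
    simpa using hf.hasFDerivAt
  have h1 := h0.comp_hasDerivAt (0:ℝ) (kelvin_line x v)
  have ht : Filter.Tendsto (fun t : ℝ => x + t • v) (nhds 0) (nhds x) := by
    simpa using (kelvin_line x v).continuousAt.tendsto
  exact h1.unique (h.congr_of_eventuallyEq (ht.eventually hG))

end KelvinAux

/-- the algebraic summation -/
lemma kelvin_sum (m : ℕ) (x : EuclideanSpace ℝ (Fin m)) (hx : x ≠ 0) (F0 : ℝ)
    (L : EuclideanSpace ℝ (Fin m) →L[ℝ] ℝ)
    (B : EuclideanSpace ℝ (Fin m) →L[ℝ] EuclideanSpace ℝ (Fin m) →L[ℝ] ℝ)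
    (a : ℝ) (ha : a = (2 - m) / 2)
    (e : Fin m → EuclideanSpace ℝ (Fin m)) (he : ∀ i, e i = EuclideanSpace.single i (1:ℝ)) :
    ∑ i, ((4 * a * (a - 1) * (‖x‖ ^ 2) ^ (a - 2) * (inner ℝ x (e i)) ^ 2
          + 2 * a * (‖x‖ ^ 2) ^ (a - 1) * inner ℝ (e i) (e i)) * F0
        + 4 * a * (‖x‖ ^ 2) ^ (a - 1) * inner ℝ x (e i) * L (kelvinD x (e i))
        + (‖x‖ ^ 2) ^ a *
          (B (kelvinD x (e i)) (kelvinD x (e i))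
          + L ((8 * ((‖x‖ ^ 2)⁻¹) ^ 3 * (inner ℝ x (e i)) ^ 2
              - 2 * ((‖x‖ ^ 2)⁻¹) ^ 2 * inner ℝ (e i) (e i)) • x
              + (-4 * ((‖x‖ ^ 2)⁻¹) ^ 2 * inner ℝ x (e i)) • (e i))))
      = (‖x‖ ^ 2) ^ (a - 2) * ∑ i, B (e i) (e i) := by
  have hN : 0 < ‖x‖ ^ 2 := by positivity
  have h1 : ∀ i, inner ℝ x (e i) = x i := by
    intro i; rw [he]; simp [EuclideanSpace.inner_single_right]
  have h2 : ∀ i, inner ℝ (e i) (e i) = (1:ℝ) := by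
    intro i; rw [he]; simp [EuclideanSpace.inner_single_right]
  have hs : ∑ i, x i ^ 2 = ‖x‖ ^ 2 := by
    rw [EuclideanSpace.norm_sq_eq]; simp
  have hxe : ∑ i, x i • e i = x := by
    ext j
    simp [he, Finset.sum_apply, Pi.single_apply]
  have hL : ∑ i, x i * L (e i) = L x := by
    conv_rhs => rw [← hxe]
    simp
  have hB1 : ∑ i, x i * B (e i) x = B x x := by
    have := congrArg (fun y => B y x) hxe
    simpa using this
  have hB2 : ∑ i, x i * B x (e i) = B x x := by
    have := congrArg (fun y => B x y) hxe
    simpa using this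
  have p1 : (‖x‖ ^ 2) ^ (a - 1) = (‖x‖ ^ 2) ^ (a - 2) * ‖x‖ ^ 2 := by
    rw [← Real.rpow_add_one hN.ne']; ring_nf
  have p0 : (‖x‖ ^ 2) ^ a = (‖x‖ ^ 2) ^ (a - 2) * (‖x‖ ^ 2) ^ 2 := by
    rw [← Real.rpow_add_natCast hN.ne']; push_cast; ring_nf
  rw [p1, p0]
  generalize (‖x‖ ^ 2) ^ (a - 2) = P
  simp only [kelvinD, h1, h2]
  generalize ‖x‖ ^ 2 = N at *
  simp only [map_add, map_smul, add_apply, smul_apply,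
    smul_eq_mul]
  have key : ∀ i, ((4 * a * (a - 1) * P * x i ^ 2 + 2 * a * (P * N) * 1) * F0
      + 4 * a * (P * N) * x i * (-2 * N⁻¹ ^ 2 * x i * L x + N⁻¹ * L (e i))
      + P * N ^ 2 * ((-2 * N⁻¹ ^ 2 * x i * (-2 * N⁻¹ ^ 2 * x i * B x x + N⁻¹ * B (e i) x)
        + N⁻¹ * (-2 * N⁻¹ ^ 2 * x i * B x (e i) + N⁻¹ * B (e i) (e i)))
        + ((8 * N⁻¹ ^ 3 * x i ^ 2 - 2 * N⁻¹ ^ 2 * 1) * L x + -4 * N⁻¹ ^ 2 * x i * L (e i))))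
      = (4 * a * (a - 1) * P * F0 + (8 - 8 * a) * P * N⁻¹ * L x + 4 * P * N⁻¹ ^ 2 * B x x) * x i ^ 2
        + (2 * a * P * N * F0 - 2 * P * L x)
        + (4 * a * P - 4 * P) * (x i * L (e i))
        - 2 * P * N⁻¹ * (x i * B (e i) x) - 2 * P * N⁻¹ * (x i * B x (e i))
        + P * B (e i) (e i) := by
    intro i; field_simp; ring
  trans ∑ i, ((4 * a * (a - 1) * P * F0 + (8 - 8 * a) * P * N⁻¹ * L x + 4 * P * N⁻¹ ^ 2 * B x x) * x i ^ 2
        + (2 * a * P * N * F0 - 2 * P * L x)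
        + (4 * a * P - 4 * P) * (x i * L (e i))
        - 2 * P * N⁻¹ * (x i * B (e i) x) - 2 * P * N⁻¹ * (x i * B x (e i))
        + P * B (e i) (e i))
  · apply Finset.sum_congr rfl
    intro i _
    rw [← key i]
  · simp only [Finset.sum_add_distrib, Finset.sum_sub_distrib, ← Finset.mul_sum, hs, hL, hB1, hB2,
      Finset.sum_const, Finset.card_univ, Fintype.card_fin, nsmul_eq_mul]
    have : (m : ℝ) = 2 - 2 * a := by rw [ha]; ring
    rw [this]
    field_simp
    ring

/-- Kelvin transform and the Laplacian: for `m ≥ 3`, `Ω ⊆ ℝ^m \ {0}` open,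
`F : Ω → ℝ` twice continuously differentiable, `Ω* = {x ≠ 0 : x/|x|² ∈ Ω}` and
`f(x) = |x|^{2-m} F(x/|x|²)`, one has
`Δf(x) = |x|^{-m-2} ΔF(x/|x|²)` for all `x ∈ Ω*`, where `Δ = Σᵢ ∂²/∂xᵢ²`. -/
theorem kelvin_transform_laplacian
    (m : ℕ) (hm : 3 ≤ m)
    (Ω : Set (EuclideanSpace ℝ (Fin m))) (hΩ : IsOpen Ω)
    (hΩ0 : (0 : EuclideanSpace ℝ (Fin m)) ∉ Ω)
    (F : EuclideanSpace ℝ (Fin m) → ℝ) (hF : ContDiffOn ℝ 2 F Ω)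
    (Ωs : Set (EuclideanSpace ℝ (Fin m)))
    (hΩs : Ωs = {x : EuclideanSpace ℝ (Fin m) | x ≠ 0 ∧ (‖x‖ ^ 2)⁻¹ • x ∈ Ω})
    (f : EuclideanSpace ℝ (Fin m) → ℝ)
    (hfdef : ∀ x ∈ Ωs, f x = ‖x‖ ^ ((2:ℝ) - m) * F ((‖x‖ ^ 2)⁻¹ • x)) :
    ∀ x ∈ Ωs,
      ∑ i : Fin m, (iteratedFDerivWithin ℝ 2 f Ωs x)
          ![EuclideanSpace.single i (1:ℝ), EuclideanSpace.single i (1:ℝ)]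
        = ‖x‖ ^ (-(m : ℝ) - 2) *
            ∑ i : Fin m, (iteratedFDerivWithin ℝ 2 F Ω ((‖x‖ ^ 2)⁻¹ • x))
              ![EuclideanSpace.single i (1:ℝ), EuclideanSpace.single i (1:ℝ)] := by
  subst hΩs
  set Ωs : Set (EuclideanSpace ℝ (Fin m)) := {x | x ≠ 0 ∧ (‖x‖ ^ 2)⁻¹ • x ∈ Ω} with hΩsdef
  have hinv : ∀ x : EuclideanSpace ℝ (Fin m), x ≠ 0 →
      ContDiffAt ℝ 2 (fun x : EuclideanSpace ℝ (Fin m) => (‖x‖ ^ 2)⁻¹ • x) x := by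
    intro x hx
    exact ((contDiff_norm_sq ℝ).contDiffAt.inv (by simpa using hx)).smul contDiffAt_id
  have hopen : IsOpen Ωs := by
    rw [isOpen_iff_mem_nhds]
    rintro x ⟨hx, hxΩ⟩
    exact Filter.inter_mem (isOpen_ne.mem_nhds hx)
      ((hinv x hx).continuousAt.preimage_mem_nhds (hΩ.mem_nhds hxΩ))
  set a : ℝ := (2 - m) / 2 with ha
  have hpow : ∀ (x : EuclideanSpace ℝ (Fin m)) (b : ℝ), ‖x‖ ^ (2 * b) = (‖x‖ ^ 2) ^ b := by
    intro x b
    rw [Real.rpow_mul (norm_nonneg x), Real.rpow_two]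
  have hf : ∀ x ∈ Ωs, f x = (‖x‖ ^ 2) ^ a * F ((‖x‖ ^ 2)⁻¹ • x) := by
    intro x hx
    rw [hfdef x hx, ← hpow, ha]
    congr 2
    ring
  have hFat : ∀ y ∈ Ω, ContDiffAt ℝ 2 F y := fun y hy => hF.contDiffAt (hΩ.mem_nhds hy)
  have hfat : ∀ x ∈ Ωs, ContDiffAt ℝ 2 f x := by
    intro x hx
    have h1 : ContDiffAt ℝ 2 (fun x : EuclideanSpace ℝ (Fin m) => (‖x‖ ^ 2) ^ a) x :=
      (contDiff_norm_sq ℝ).contDiffAt.rpow_const_of_ne (by simpa using hx.1)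
    have h2 : ContDiffAt ℝ 2 (fun x : EuclideanSpace ℝ (Fin m) => F ((‖x‖ ^ 2)⁻¹ • x)) x :=
      ContDiffAt.comp x (hFat _ hx.2) (hinv x hx.1)
    exact (h1.mul h2).congr_of_eventuallyEq (Filter.eventually_of_mem (hopen.mem_nhds hx) hf)
  have hgrad : ∀ x ∈ Ωs, ∀ v, fderiv ℝ f x v = kelvinG a F x v := by
    intro x hx v
    exact kelvin_grad f (fun x => (‖x‖ ^ 2) ^ a * F ((‖x‖ ^ 2)⁻¹ • x)) x v _
      ((hfat x hx).differentiableAt (by norm_num))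
      (Filter.eventually_of_mem (hopen.mem_nhds hx) hf)
      (kelvin_first a F x v hx.1 ((hFat _ hx.2).differentiableAt (by norm_num)))
  have hd2 : ∀ (g : EuclideanSpace ℝ (Fin m) → ℝ) x, ContDiffAt ℝ 2 g x →
      DifferentiableAt ℝ (fderiv ℝ g) x := by
    intro g x h
    exact (h.fderiv_right (m := 1) (by norm_num)).differentiableAt (by norm_num)
  intro x hx
  have hhess : ∀ v, fderiv ℝ (fderiv ℝ f) x v v = _ := fun v =>
    kelvin_hess f (fun z => kelvinG a F z v) x v _ (hd2 f x (hfat x hx))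
      (Filter.eventually_of_mem (hopen.mem_nhds hx) (fun z hz => hgrad z hz v))
      (kelvin_second a F x v hx.1 ((hFat _ hx.2).differentiableAt (by norm_num))
        (hd2 F _ (hFat _ hx.2)))
  rw [iteratedFDerivWithin_of_isOpen 2 hopen hx, iteratedFDerivWithin_of_isOpen 2 hΩ hx.2]
  simp only [iteratedFDeriv_two_apply, Matrix.cons_val_zero, Matrix.cons_val_one]
  have hexp : ‖x‖ ^ (-(m : ℝ) - 2) = (‖x‖ ^ 2) ^ (a - 2) := by
    rw [← hpow, ha]
    congr 1
    ring
  rw [hexp]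
  simp only [hhess]
  exact kelvin_sum m x hx.1 _ _ _ a ha _ (fun i => rfl)
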